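/- Let σ be a finite sequence of natural numbers in sawtooth form. If P is an unpierced box or an unpierced hexagon of type 1 or type 2 of G(σ) such that no unpierced box and no unpierced hexagon of type 1 or type 2 of G(σ) is strictly inside P (that is, P is innermost among all unpierced boxes and hexagons of type 1 and 2), then P is empty. -/

import Mathlib

/-- A finite sequence of natural numbers is in sawtooth form if whenever an entry
is less than the next one, the next one is exactly one more. -/
def Sawtooth (σ : List ℕ) : Prop :=
  ∀ i : ℕ, i + 1 < σ.length →
    σ.getD i 0 < σ.getD (i + 1) 0 → σ.getD (i + 1) 0 = σ.getD i 0 + 1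

/-- A commutation swaps two adjacent entries whose values differ by more than 1. -/
def Commutation (σ τ : List ℕ) : Prop :=
  ∃ (l r : List ℕ) (x y : ℕ),
    (x + 1 < y ∨ y + 1 < x) ∧ σ = l ++ x :: y :: r ∧ τ = l ++ y :: x :: r

/-- `(i, j)` is a dot of the dot graph `G(σ)` (the first coordinate is 1-based). -/
def IsDot (σ : List ℕ) (i j : ℤ) : Prop :=
  ∃ k : Fin σ.length, i = ((k : ℕ) : ℤ) + 1 ∧ j = ((σ.get k : ℕ) : ℤ)

/-- The dots `(a, y), (a+1, y+1), …, (a+t, y+t)` all belong to `G(σ)`; equivalently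
(for `0 ≤ t`) the dots `(a, y)` and `(a+t, y+t)` lie on a common ascending segment. -/
def OnAsc (σ : List ℕ) (a y t : ℤ) : Prop :=
  ∀ s : ℤ, 0 ≤ s → s ≤ t → IsDot σ (a + s) (y + s)

/-- The dots `(a, y), …, (a+m, y+m)` form an entire (i.e. maximal) ascending segment. -/
def IsAscSeg (σ : List ℕ) (a y : ℤ) (m : ℕ) : Prop :=
  OnAsc σ a y (m : ℤ) ∧ ¬ IsDot σ (a - 1) (y - 1) ∧
    ¬ IsDot σ (a + (m : ℤ) + 1) (y + (m : ℤ) + 1)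

/-- A box of `G(σ)` with lower horizontal edge from `(a, y)` to `(b, y)` and
ascending edges of length `t`. -/
def IsBox (σ : List ℕ) (a b y t : ℤ) : Prop :=
  0 ≤ t ∧ a + t < b ∧
  OnAsc σ a y t ∧ ¬ IsDot σ (a + t + 1) (y + t + 1) ∧
  OnAsc σ b y t ∧ ¬ IsDot σ (b - 1) (y - 1)

/-- No dot of `G(σ)` lies in the open interior of either horizontal edge of the box. -/
def BoxUnpierced (σ : List ℕ) (a b y t : ℤ) : Prop :=
  (∀ i : ℤ, a < i → i < b → ¬ IsDot σ i y) ∧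
  (∀ i : ℤ, a + t < i → i < b + t → ¬ IsDot σ i (y + t))

/-- No dot of `G(σ)` lies in the open interior of the box. -/
def BoxEmpty (σ : List ℕ) (a b y t : ℤ) : Prop :=
  ∀ i h : ℤ, y < h → h < y + t → a + (h - y) < i → i < b + (h - y) → ¬ IsDot σ i h

/-- The closed region of the box. -/
def BoxRegion (a b y t : ℤ) : Set (ℤ × ℤ) :=
  {p | y ≤ p.2 ∧ p.2 ≤ y + t ∧ a + (p.2 - y) ≤ p.1 ∧ p.1 ≤ b + (p.2 - y)}

/-- A hexagon of type 1 of `G(σ)`. -/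
def IsHex1 (σ : List ℕ) (a b c y L M : ℤ) : Prop :=
  0 ≤ M ∧ M ≤ L ∧ a < b ∧ b + M < c ∧
  OnAsc σ a y L ∧ ¬ IsDot σ (a + L + 1) (y + L + 1) ∧
  OnAsc σ b y M ∧ ¬ IsDot σ (b - 1) (y - 1) ∧ ¬ IsDot σ (b + M + 1) (y + M + 1) ∧
  OnAsc σ c (y + M) (L - M)

/-- No dot of `G(σ)` lies in the open interior of any of the three horizontal
edges of the type 1 hexagon. -/
def Hex1Unpierced (σ : List ℕ) (a b c y L M : ℤ) : Prop :=
  (∀ i : ℤ, a < i → i < b → ¬ IsDot σ i y) ∧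
  (∀ i : ℤ, b + M < i → i < c → ¬ IsDot σ i (y + M)) ∧
  (∀ i : ℤ, a + L < i → i < c + L - M → ¬ IsDot σ i (y + L))

/-- The open interior of the type 1 hexagon. -/
def Hex1Interior (a b c y L M : ℤ) : Set (ℤ × ℤ) :=
  {p | y < p.2 ∧ p.2 < y + L ∧ a + (p.2 - y) < p.1 ∧
    (p.2 ≤ y + M → p.1 < b + (p.2 - y)) ∧ (y + M ≤ p.2 → p.1 < c + (p.2 - y - M))}

/-- No dot of `G(σ)` lies in the open interior of the type 1 hexagon. -/
def Hex1Empty (σ : List ℕ) (a b c y L M : ℤ) : Prop :=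
  ∀ p ∈ Hex1Interior a b c y L M, ¬ IsDot σ p.1 p.2

/-- The closed region of the type 1 hexagon (open interior together with its
horizontal and ascending edges). -/
def Hex1Region (a b c y L M : ℤ) : Set (ℤ × ℤ) :=
  {p | y ≤ p.2 ∧ p.2 ≤ y + L ∧ a + (p.2 - y) ≤ p.1 ∧
    (p.2 < y + M → p.1 ≤ b + (p.2 - y)) ∧ (y + M ≤ p.2 → p.1 ≤ c + (p.2 - y - M))}

/-- A hexagon of type 2 of `G(σ)`. -/
def IsHex2 (σ : List ℕ) (p q r y L M : ℤ) : Prop :=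
  0 ≤ M ∧ M ≤ L ∧ p < q ∧ p + (L - M) < r ∧ r + M < q + L ∧
  OnAsc σ p y (L - M) ∧
  OnAsc σ r (y + L - M) M ∧ ¬ IsDot σ (r - 1) (y + L - M - 1) ∧
    ¬ IsDot σ (r + M + 1) (y + L + 1) ∧
  OnAsc σ q y L ∧ ¬ IsDot σ (q - 1) (y - 1)

/-- No dot of `G(σ)` lies in the open interior of any of the three horizontal
edges of the type 2 hexagon. -/
def Hex2Unpierced (σ : List ℕ) (p q r y L M : ℤ) : Prop :=
  (∀ i : ℤ, p < i → i < q → ¬ IsDot σ i y) ∧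
  (∀ i : ℤ, p + (L - M) < i → i < r → ¬ IsDot σ i (y + L - M)) ∧
  (∀ i : ℤ, r + M < i → i < q + L → ¬ IsDot σ i (y + L))

/-- The open interior of the type 2 hexagon. -/
def Hex2Interior (p q r y L M : ℤ) : Set (ℤ × ℤ) :=
  {x | y < x.2 ∧ x.2 < y + L ∧ x.1 < q + (x.2 - y) ∧
    (x.2 ≤ y + L - M → p + (x.2 - y) < x.1) ∧
    (y + L - M ≤ x.2 → r + (x.2 - y - L + M) < x.1)}

/-- No dot of `G(σ)` lies in the open interior of the type 2 hexagon. -/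
def Hex2Empty (σ : List ℕ) (p q r y L M : ℤ) : Prop :=
  ∀ x ∈ Hex2Interior p q r y L M, ¬ IsDot σ x.1 x.2

/-- The closed region of the type 2 hexagon (open interior together with its
horizontal and ascending edges). -/
def Hex2Region (p q r y L M : ℤ) : Set (ℤ × ℤ) :=
  {x | y ≤ x.2 ∧ x.2 ≤ y + L ∧ x.1 ≤ q + (x.2 - y) ∧
    (x.2 ≤ y + L - M → p + (x.2 - y) ≤ x.1) ∧
    (y + L - M < x.2 → r + (x.2 - y - L + M) ≤ x.1)}

/-- The number of dots of `G(σ)` lying in a region `R`. -/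
noncomputable def DotsIn (σ : List ℕ) (R : Set (ℤ × ℤ)) : ℕ :=
  {p : ℤ × ℤ | IsDot σ p.1 p.2 ∧ p ∈ R}.ncard

/-- A region `RQ` is strictly inside a region `RP` (with respect to `G(σ)`) if
`RQ ⊆ RP` and `RQ` contains strictly fewer dots of `G(σ)` than `RP`. -/
def StrictlyInside (σ : List ℕ) (RQ RP : Set (ℤ × ℤ)) : Prop :=
  RQ ⊆ RP ∧ DotsIn σ RQ < DotsIn σ RP

/-- A dot graph polygon: a box, a hexagon of type 1, or a hexagon of type 2. -/
inductive DGPoly : Type where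
  | box (a b y t : ℤ)
  | hex1 (a b c y L M : ℤ)
  | hex2 (p q r y L M : ℤ)

/-- The polygon is genuinely a box/hexagon of type 1/hexagon of type 2 of `G(σ)`. -/
def DGPoly.Valid (σ : List ℕ) : DGPoly → Prop
  | .box a b y t => IsBox σ a b y t
  | .hex1 a b c y L M => IsHex1 σ a b c y L M
  | .hex2 p q r y L M => IsHex2 σ p q r y L M

/-- The polygon is unpierced. -/
def DGPoly.Unpierced (σ : List ℕ) : DGPoly → Prop
  | .box a b y t => BoxUnpierced σ a b y t
  | .hex1 a b c y L M => Hex1Unpierced σ a b c y L M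
  | .hex2 p q r y L M => Hex2Unpierced σ p q r y L M

/-- The polygon is empty. -/
def DGPoly.IsEmpty (σ : List ℕ) : DGPoly → Prop
  | .box a b y t => BoxEmpty σ a b y t
  | .hex1 a b c y L M => Hex1Empty σ a b c y L M
  | .hex2 p q r y L M => Hex2Empty σ p q r y L M

/-- The closed region of the polygon. -/
def DGPoly.Region : DGPoly → Set (ℤ × ℤ)
  | .box a b y t => BoxRegion a b y t
  | .hex1 a b c y L M => Hex1Region a b c y L M
  | .hex2 p q r y L M => Hex2Region p q r y L M

/-- The height of the dot in column `x` of `G(σ)`, for `1 ≤ x ≤ σ.length`. -/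
def dotHeight (σ : List ℕ) (x : ℤ) : ℤ := (σ.getD (x - 1).toNat 0 : ℕ)

theorem isDot_iff {σ : List ℕ} {x h : ℤ} :
    IsDot σ x h ↔ 1 ≤ x ∧ x ≤ σ.length ∧ dotHeight σ x = h := by
  constructor
  · rintro ⟨⟨k, hk⟩, rfl, rfl⟩
    refine ⟨by omega, by simp only; omega, ?_⟩
    simp [dotHeight, hk]
  · rintro ⟨h1, h2, rfl⟩
    have hk : (x - 1).toNat < σ.length := by omega
    refine ⟨⟨(x - 1).toNat, hk⟩, by simp only; omega, ?_⟩
    rw [dotHeight, List.getD_eq_getElem _ _ hk]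
    rfl

theorem onAsc_iff {σ : List ℕ} {a y t : ℤ} (ht : 0 ≤ t) :
    OnAsc σ a y t ↔ 1 ≤ a ∧ a + t ≤ σ.length ∧
      ∀ x, a ≤ x → x ≤ a + t → dotHeight σ x = y + (x - a) := by
  simp only [OnAsc, isDot_iff]
  constructor
  · intro h
    have h0 := h 0 le_rfl ht
    have h1 := h t ht le_rfl
    refine ⟨by omega, by omega, fun x hx hx' => ?_⟩
    have h2 := h (x - a) (by omega) (by omega)
    rw [show a + (x - a) = x by ring] at h2
    exact h2.2.2
  · rintro ⟨h1, h2, h3⟩ s hs hst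
    refine ⟨by omega, by omega, ?_⟩
    rw [h3 _ (by omega) (by omega)]
    ring

theorem Sawtooth.dotHeight_succ_le {σ : List ℕ} (hσ : Sawtooth σ) {x : ℤ} (h1 : 1 ≤ x)
    (h2 : x < σ.length) : dotHeight σ (x + 1) ≤ dotHeight σ x + 1 := by
  have h := hσ (x - 1).toNat (by omega)
  have e : (x + 1 - 1).toNat = (x - 1).toNat + 1 := by omega
  simp only [dotHeight, e]
  omega

/-- Along a sawtooth sequence the diagonal `x - h` of the dots is monotone. -/
theorem Sawtooth.dotHeight_sub_le {σ : List ℕ} (hσ : Sawtooth σ) {x z : ℤ} (h1 : 1 ≤ x)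
    (hxz : x ≤ z) (h2 : z ≤ σ.length) : x - dotHeight σ x ≤ z - dotHeight σ z := by
  induction z, hxz using Int.leInduction with
  | base => exact le_rfl
  | succ z hz ih =>
    have := ih (by omega)
    have := hσ.dotHeight_succ_le (x := z) (by omega) (by omega)
    omega

/-- A sawtooth sequence cannot climb past a height without attaining it. -/
theorem Sawtooth.dotHeight_lt_of_avoid {σ : List ℕ} (hσ : Sawtooth σ) {x z h : ℤ} (h1 : 1 ≤ x)
    (hxz : x ≤ z) (h2 : z ≤ σ.length) (hx : dotHeight σ x < h)
    (hav : ∀ w, x < w → w ≤ z → dotHeight σ w ≠ h) : dotHeight σ z < h := by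
  induction z, hxz using Int.leInduction with
  | base => exact hx
  | succ z hz ih =>
    have := ih (by omega) fun w hw hw' => hav w hw (by omega)
    have := hσ.dotHeight_succ_le (x := z) (by omega) (by omega)
    have := hav (z + 1) (by omega) le_rfl
    omega

/-- After the highest dot of an ascending segment, a sawtooth sequence stays below its height
for as long as that height is avoided. -/
theorem Sawtooth.dotHeight_lt_of_top {σ : List ℕ} (hσ : Sawtooth σ) {A U z : ℤ} (hA : 1 ≤ A)
    (hU : dotHeight σ A = U) (htop : ¬ IsDot σ (A + 1) (U + 1)) (hAz : A < z)
    (hz : z ≤ σ.length) (hav : ∀ w, A < w → w ≤ z → dotHeight σ w ≠ U) :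
    dotHeight σ z < U := by
  rw [isDot_iff] at htop
  have := hσ.dotHeight_succ_le (x := A) (by omega) (by omega)
  have := hav (A + 1) (by omega) (by omega)
  exact hσ.dotHeight_lt_of_avoid (x := A + 1) (by omega) (by omega) hz (by omega)
    fun w hw => hav w (by omega)

/-- Before the lowest dot of an ascending segment, a sawtooth sequence stays above its height
for as long as that height is avoided. -/
theorem Sawtooth.lt_dotHeight_of_bot {σ : List ℕ} (hσ : Sawtooth σ) {B V x : ℤ}
    (hB : B ≤ σ.length) (hV : dotHeight σ B = V) (hbot : ¬ IsDot σ (B - 1) (V - 1)) (hx : 1 ≤ x)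
    (hxB : x < B) (hav : ∀ w, x ≤ w → w < B → dotHeight σ w ≠ V) : V < dotHeight σ x := by
  rw [isDot_iff] at hbot
  have h1 := hσ.dotHeight_succ_le (x := B - 1) (by omega) (by omega)
  rw [sub_add_cancel] at h1
  have := hav (B - 1) (by omega) (by omega)
  by_contra hlt
  have := hav x le_rfl hxB
  have := hσ.dotHeight_lt_of_avoid (x := x) (z := B - 1) (h := V) hx (by omega) (by omega)
    (by omega) fun w hw hw' => hav w (by omega) (by omega)
  omega

theorem exists_asc_top {σ : List ℕ} {x : ℤ} (h1 : 1 ≤ x) (h2 : x ≤ σ.length) :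
    ∃ t, 0 ≤ t ∧ OnAsc σ x (dotHeight σ x) t ∧ ¬ IsDot σ (x + t + 1) (dotHeight σ x + t + 1) := by
  obtain ⟨t, ⟨ht, hasc⟩, hmax⟩ := Int.exists_greatest_of_bdd
    (P := fun t => 0 ≤ t ∧ OnAsc σ x (dotHeight σ x) t)
    ⟨σ.length - x, fun t ht => by have := (onAsc_iff ht.1).1 ht.2; omega⟩
    ⟨0, le_rfl, (onAsc_iff le_rfl).2 ⟨h1, by omega, fun w hw hw' => by
      obtain rfl : w = x := by omega
      ring⟩⟩
  refine ⟨t, ht, hasc, fun hd => ?_⟩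
  have := hmax (t + 1) ⟨by omega, fun s hs hs' => ?_⟩
  · omega
  · rcases hs'.eq_or_lt with rfl | hlt
    · simpa only [add_assoc] using hd
    · exact hasc s hs (by omega)

theorem exists_asc_bot {σ : List ℕ} {x : ℤ} (h1 : 1 ≤ x) (h2 : x ≤ σ.length) :
    ∃ t, 0 ≤ t ∧ OnAsc σ (x - t) (dotHeight σ x - t) t ∧
      ¬ IsDot σ (x - t - 1) (dotHeight σ x - t - 1) := by
  obtain ⟨t, ⟨ht, hasc⟩, hmax⟩ := Int.exists_greatest_of_bdd
    (P := fun t => 0 ≤ t ∧ OnAsc σ (x - t) (dotHeight σ x - t) t)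
    ⟨x - 1, fun t ht => by have := (onAsc_iff ht.1).1 ht.2; omega⟩
    ⟨0, le_rfl, (onAsc_iff le_rfl).2 ⟨by omega, by omega, fun w hw hw' => by
      obtain rfl : w = x := by omega
      ring⟩⟩
  refine ⟨t, ht, hasc, fun hd => ?_⟩
  have := hmax (t + 1) ⟨by omega, fun s hs hs' => ?_⟩
  · omega
  · rcases hs.eq_or_lt with rfl | hlt
    · convert hd using 1 <;> ring
    · convert hasc (s - 1) (by omega) (by omega) using 1 <;> ring

theorem Int.exists_first_between {p : ℤ → Prop} {a b : ℤ} (h : ∃ x, a < x ∧ x < b ∧ p x) :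
    ∃ x, a < x ∧ x < b ∧ p x ∧ ∀ w, a < w → w < x → ¬ p w := by
  obtain ⟨x, ⟨h1, h2, h3⟩, hmin⟩ := Int.exists_least_of_bdd ⟨a, fun z hz => hz.1.le⟩ h
  exact ⟨x, h1, h2, h3, fun w hw hw' hp => by have := hmin w ⟨hw, by omega, hp⟩; omega⟩

theorem Int.exists_last_between {p : ℤ → Prop} {a b : ℤ} (h : ∃ x, a < x ∧ x < b ∧ p x) :
    ∃ x, a < x ∧ x < b ∧ p x ∧ ∀ w, x < w → w < b → ¬ p w := by
  obtain ⟨x, ⟨h1, h2, h3⟩, hmax⟩ := Int.exists_greatest_of_bdd ⟨b, fun z hz => hz.2.1.le⟩ h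
  exact ⟨x, h1, h2, h3, fun w hw hw' hp => by have := hmax w ⟨by omega, hw', hp⟩; omega⟩

/-- A box with at least one unpierced horizontal edge contains an unpierced box. -/
theorem exists_unpierced_box {σ : List ℕ} (hσ : Sawtooth σ) {a b y t : ℤ} (hbox : IsBox σ a b y t)
    (hav : (∀ i, a < i → i < b → dotHeight σ i ≠ y) ∨
      (∀ i, a + t < i → i < b → dotHeight σ i ≠ y + t)) :
    ∃ a' b' y' t', IsBox σ a' b' y' t' ∧ BoxUnpierced σ a' b' y' t' ∧
      a ≤ a' ∧ b' ≤ b ∧ y ≤ y' ∧ y' + t' ≤ y + t := by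
  obtain ⟨n, hn⟩ : ∃ n : ℕ, b - a ≤ n := ⟨(b - a).toNat, by omega⟩
  induction n generalizing a b y t with
  | zero => obtain ⟨h1, h2, -⟩ := hbox; omega
  | succ n ih =>
    have hbox' := hbox
    obtain ⟨ht, hab, hl, htop, hr, hbot⟩ := hbox
    obtain ⟨hl1, hl2, hl3⟩ := (onAsc_iff ht).1 hl
    obtain ⟨hr1, hr2, hr3⟩ := (onAsc_iff ht).1 hr
    by_cases hboth : (∀ i, a < i → i < b → dotHeight σ i ≠ y) ∧
      (∀ i, a + t < i → i < b → dotHeight σ i ≠ y + t)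
    · refine ⟨a, b, y, t, hbox', ⟨fun i h1 h2 hd => hboth.1 i h1 h2 (isDot_iff.1 hd).2.2,
        fun i h1 h2 hd => ?_⟩, le_rfl, le_rfl, le_rfl, le_rfl⟩
      have hd := (isDot_iff.1 hd).2.2
      rcases lt_or_ge i b with hib | hib
      · exact hboth.2 i h1 hib hd
      · have := hr3 i hib (by omega)
        omega
    rcases hav with hav | hav
    · have hex : ∃ i, a + t < i ∧ i < b ∧ dotHeight σ i = y + t := by
        by_contra! h
        exact hboth ⟨hav, h⟩
      obtain ⟨k, hk1, hk2, hk3, hk4⟩ := Int.exists_first_between hex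
      obtain ⟨s, hs, hsa, hsb⟩ := exists_asc_bot (σ := σ) (x := k) (by omega) (by omega)
      obtain ⟨hs1, hs2, hs3⟩ := (onAsc_iff hs).1 hsa
      have hks : a + t < k - s := by
        by_contra hlt
        have h1 := hs3 (a + t) (by omega) (by omega)
        have h2 := hl3 (a + t) (by omega) (by omega)
        omega
      have habove := hσ.lt_dotHeight_of_bot (x := k - s) (by omega) (hr3 b le_rfl (by omega))
        (by simpa using hbot) hs1 (by omega) fun w h1 h2 h3 => hav w (by omega) h2 (by omega)
      have h0 := hs3 (k - s) le_rfl (by omega)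
      obtain ⟨a', b', y', t', h1, h2, h3, h4, h5, h6⟩ := ih
        (a := a + (t - s)) (b := k - s) (y := y + t - s) (t := s)
        ⟨hs, by omega, (onAsc_iff hs).2 ⟨by omega, by omega, fun x hx hx' => by
            have := hl3 x (by omega) (by omega); omega⟩,
          by convert htop using 2 <;> ring, by rwa [← hk3], by rwa [← hk3]⟩
        (Or.inr fun i hi hi' hd => hk4 i (by omega) (by omega) (by omega)) (by omega)
      exact ⟨a', b', y', t', h1, h2, by omega, by omega, by omega, by omega⟩
    · have hex : ∃ i, a < i ∧ i < b ∧ dotHeight σ i = y := by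
        by_contra! h
        exact hboth ⟨h, hav⟩
      obtain ⟨k, hk1, hk2, hk3, hk4⟩ := Int.exists_last_between hex
      have hkt : a + t < k := by
        by_contra hlt
        have := hl3 k (by omega) (by omega)
        omega
      obtain ⟨s, hs, hsa, hsb⟩ := exists_asc_top (σ := σ) (x := k) (by omega) (by omega)
      obtain ⟨hs1, hs2, hs3⟩ := (onAsc_iff hs).1 hsa
      have hks : k + s < b := by
        by_contra hlt
        have h1 := hs3 b (by omega) (by omega)
        have h2 := hr3 b (by omega) (by omega)
        omega
      have hbelow := hσ.dotHeight_lt_of_top (z := k + s) (A := a + t) (by omega)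
        ((hl3 (a + t) (by omega) (by omega)).trans (by ring)) htop (by omega) (by omega)
        fun w h1 h2 => hav w h1 (by omega)
      have h0 := hs3 (k + s) (by omega) le_rfl
      obtain ⟨a', b', y', t', h1, h2, h3, h4, h5, h6⟩ := ih
        (a := k) (b := b) (y := y) (t := s)
        ⟨hs, hks, by rwa [← hk3], by rwa [← hk3], (onAsc_iff hs).2 ⟨by omega, by omega,
          fun x hx hx' => hr3 x hx (by omega)⟩, hbot⟩
        (Or.inl hk4) (by omega)
      exact ⟨a', b', y', t', h1, h2, by omega, by omega, by omega, by omega⟩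

/-- `(x, h), …, (x + m, h + m)` is an entire ascending segment lying strictly between the columns
`A`, `B` and the heights `V`, `U`, such that its lowest dot is the first and its highest dot
the last dot of its height between those columns. -/
def IsolatedSeg (σ : List ℕ) (A B V U x h m : ℤ) : Prop :=
  0 ≤ m ∧ A < x ∧ x + m < B ∧ V < h ∧ h + m < U ∧ OnAsc σ x h m ∧
    ¬ IsDot σ (x - 1) (h - 1) ∧ ¬ IsDot σ (x + m + 1) (h + m + 1) ∧
    (∀ w, A < w → w < x → dotHeight σ w ≠ h) ∧
    (∀ w, x + m < w → w < B → dotHeight σ w ≠ h + m)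

/-- `(a, b, y, t)` is an unpierced box whose lower corners lie strictly between the columns
`A`, `B` and which lies strictly between the heights `V`, `U`. -/
def UnpiercedBoxBetween (σ : List ℕ) (A B V U a b y t : ℤ) : Prop :=
  IsBox σ a b y t ∧ BoxUnpierced σ a b y t ∧ A < a ∧ b < B ∧ V < y ∧ y + t < U

theorem exists_isolatedSeg_or_box {σ : List ℕ} (hσ : Sawtooth σ) {A B V U i : ℤ}
    (hA : 1 ≤ A) (hB : B ≤ σ.length) (hAi : A < i) (hiB : i < B)
    (hU : dotHeight σ A = U) (hV : dotHeight σ B = V)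
    (hz : ∀ x, A < x → x < B → V < dotHeight σ x ∧ dotHeight σ x < U) :
    (∃ x h m, IsolatedSeg σ A B V U x h m) ∨
      ∃ a b y t, UnpiercedBoxBetween σ A B V U a b y t := by
  obtain ⟨u, ⟨k₀, hk₀, hk₀', hk₀u⟩, hmax⟩ := Int.exists_greatest_of_bdd
    (P := fun u => ∃ x, A < x ∧ x < B ∧ dotHeight σ x = u)
    ⟨U, fun u ⟨x, h1, h2, h3⟩ => by have := hz x h1 h2; omega⟩ ⟨_, i, hAi, hiB, rfl⟩
  obtain ⟨k, hk1, hk2, hk3, hk4⟩ := Int.exists_last_between (p := fun x => dotHeight σ x = u)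
    ⟨k₀, hk₀, hk₀', hk₀u⟩
  have hle : ∀ x, A < x → x < B → dotHeight σ x ≤ u := fun x h1 h2 => hmax _ ⟨x, h1, h2, rfl⟩
  have huU := hz k hk1 hk2
  obtain ⟨m, hm, hma, hmb⟩ := exists_asc_bot (σ := σ) (x := k) (by omega) (by omega)
  obtain ⟨hm1, hm2, hm3⟩ := (onAsc_iff hm).1 hma
  have hkm : A < k - m := by
    by_contra hlt
    have := hm3 A (by omega) (by omega)
    omega
  have hbot := hm3 (k - m) le_rfl (by omega)
  have hVl := hz (k - m) hkm (by omega)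
  rw [hk3] at hma hmb hm3 hbot
  by_cases hfirst : ∀ w, A < w → w < k - m → dotHeight σ w ≠ u - m
  · left
    refine ⟨k - m, u - m, m, hm, hkm, by omega, by omega, by omega, hma, hmb, ?_, hfirst, ?_⟩
    · rw [isDot_iff]
      rintro ⟨-, h2, h3⟩
      rw [sub_add_cancel] at h2 h3
      rcases eq_or_ne (k + 1) B with hB' | hB'
      · rw [hB'] at h3
        omega
      · have := hle (k + 1) (by omega) (by omega)
        omega
    · intro w h1 h2 h3
      exact hk4 w (by omega) h2 (by omega)
  · right
    have hex : ∃ w, A < w ∧ w < k - m ∧ dotHeight σ w = u - m := by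
      by_contra! h
      exact hfirst h
    obtain ⟨x, hx1, hx2, hx3, hx4⟩ := Int.exists_last_between hex
    obtain ⟨t, ht, hta, htb⟩ := exists_asc_top (σ := σ) (x := x) (by omega) (by omega)
    obtain ⟨ht1, ht2, ht3⟩ := (onAsc_iff ht).1 hta
    have hxt : x + t < k - m := by
      by_contra hlt
      have := ht3 (k - m) (by omega) (by omega)
      omega
    have htu := hle (x + t) (by omega) (by omega)
    have htx := ht3 (x + t) (by omega) le_rfl
    rw [hx3] at hta htb htx
    obtain ⟨a, b, y, s, h1, h2, h3, h4, h5, h6⟩ := exists_unpierced_box hσ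
      (a := x) (b := k - m) (y := u - m) (t := t)
      ⟨ht, hxt, hta, htb, (onAsc_iff ht).2 ⟨by omega, by omega,
        fun w hw hw' => hm3 w hw (by omega)⟩, hmb⟩ (Or.inl hx4)
    exact ⟨a, b, y, s, h1, h2, by omega, by omega, by omega, by omega⟩

theorem finite_dots (σ : List ℕ) : {p : ℤ × ℤ | IsDot σ p.1 p.2}.Finite := by
  refine (Set.finite_range fun k : Fin σ.length =>
    (((k : ℕ) : ℤ) + 1, ((σ.get k : ℕ) : ℤ))).subset ?_
  rintro ⟨i, j⟩ ⟨k, hi, hj⟩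
  exact ⟨k, Prod.ext hi.symm hj.symm⟩

theorem strictlyInside_of_dot {σ : List ℕ} {R R' : Set (ℤ × ℤ)} (hsub : R ⊆ R') {x h : ℤ}
    (hd : IsDot σ x h) (hmem : (x, h) ∈ R') (hnot : (x, h) ∉ R) : StrictlyInside σ R R' := by
  refine ⟨hsub, Set.ncard_lt_ncard ?_ ((finite_dots σ).subset fun p hp => hp.1)⟩
  refine ⟨fun p hp => ⟨hp.1, hsub hp.2⟩, fun hss => hnot (hss ⟨hd, hmem⟩ : _ ∧ _).2⟩

theorem Sawtooth.dotHeight_mem_Ioo {σ : List ℕ} (hσ : Sawtooth σ) {A B U V : ℤ} (hA : 1 ≤ A)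
    (hB : B ≤ σ.length) (hU : dotHeight σ A = U) (htop : ¬ IsDot σ (A + 1) (U + 1))
    (hV : dotHeight σ B = V) (hbot : ¬ IsDot σ (B - 1) (V - 1))
    (hav : ∀ w, A < w → w < B → dotHeight σ w ≠ U ∧ dotHeight σ w ≠ V) :
    ∀ x, A < x → x < B → V < dotHeight σ x ∧ dotHeight σ x < U := fun x h1 h2 =>
  ⟨hσ.lt_dotHeight_of_bot hB hV hbot (by omega) h2 fun w h3 h4 => (hav w (by omega) h4).2,
    hσ.dotHeight_lt_of_top hA hU htop h1 (by omega) fun w h3 h4 => (hav w h3 (by omega)).1⟩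

theorem UnpiercedBoxBetween.diagonal_bounds {σ : List ℕ} (hσ : Sawtooth σ) {A B U V a b y t : ℤ}
    (hA : 1 ≤ A) (hB : B ≤ σ.length) (hU : dotHeight σ A = U) (hV : dotHeight σ B = V)
    (hQ : UnpiercedBoxBetween σ A B V U a b y t) : A - U ≤ a - y ∧ b - y ≤ B - V := by
  obtain ⟨⟨ht, -, hl, -, hr, -⟩, -, hAa, hbB, -, -⟩ := hQ
  obtain ⟨hl1, hl2, hl3⟩ := (onAsc_iff ht).1 hl
  obtain ⟨hr1, hr2, hr3⟩ := (onAsc_iff ht).1 hr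
  have h1 := hl3 a le_rfl (by omega)
  have h2 := hr3 b le_rfl (by omega)
  have h3 := hσ.dotHeight_sub_le hA hAa.le (by omega)
  have h4 := hσ.dotHeight_sub_le (x := b) (by omega) hbB.le hB
  omega

theorem IsolatedSeg.diagonal_bounds {σ : List ℕ} (hσ : Sawtooth σ) {A B U V x h m : ℤ}
    (hA : 1 ≤ A) (hB : B ≤ σ.length) (hU : dotHeight σ A = U) (hV : dotHeight σ B = V)
    (hT : IsolatedSeg σ A B V U x h m) : A - U ≤ x - h ∧ x - h ≤ B - V := by
  obtain ⟨hm, hAx, hxB, -, -, hT, -⟩ := hT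
  obtain ⟨h1, h2, h3⟩ := (onAsc_iff hm).1 hT
  have h4 := h3 x le_rfl (by omega)
  have h5 := hσ.dotHeight_sub_le hA hAx.le (by omega)
  have h6 := hσ.dotHeight_sub_le (x := x) (by omega) (by omega : x ≤ B) hB
  omega

theorem boxEmpty_of_innermost {σ : List ℕ} (hσ : Sawtooth σ) {a b y t : ℤ}
    (hv : IsBox σ a b y t) (hu : BoxUnpierced σ a b y t)
    (hinner : ∀ Q : DGPoly, Q.Valid σ → Q.Unpierced σ →
      ¬ StrictlyInside σ Q.Region (BoxRegion a b y t)) : BoxEmpty σ a b y t := by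
  intro i h hyh hht hai hib hd
  obtain ⟨ht, hab, hl, htop, hr, hbot⟩ := hv
  have hda : IsDot σ a y := by simpa using hl 0 le_rfl ht
  obtain ⟨hl1, hl2, hl3⟩ := (onAsc_iff ht).1 hl
  obtain ⟨hr1, hr2, hr3⟩ := (onAsc_iff ht).1 hr
  simp only [BoxUnpierced, isDot_iff] at hu
  obtain ⟨hu1, hu2⟩ := hu
  obtain ⟨hi1, hi2, hih⟩ := isDot_iff.1 hd
  have hAi : a + t < i := by
    by_contra hlt
    have := hl3 i (by omega) (by omega)
    omega
  have hiB : i < b := by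
    by_contra hlt
    have := hr3 i (by omega) (by omega)
    omega
  have hU : dotHeight σ (a + t) = y + t := by rw [hl3 _ (by omega) le_rfl]; ring
  have hV : dotHeight σ b = y := by rw [hr3 _ le_rfl (by omega)]; ring
  have hz := hσ.dotHeight_mem_Ioo (by omega) (by omega) hU htop hV hbot fun w h1 h2 =>
    ⟨fun h3 => hu2 w h1 (by omega) ⟨by omega, by omega, h3⟩,
      fun h3 => hu1 w (by omega) h2 ⟨by omega, by omega, h3⟩⟩
  rcases exists_isolatedSeg_or_box hσ (by omega) (by omega) hAi hiB hU hV hz with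
    ⟨x, l, m, hT⟩ | ⟨a', b', y', t', hQ⟩
  · have hdiag := hT.diagonal_bounds hσ (by omega) (by omega) hU hV
    obtain ⟨hm, hAx, hxB, hVl, hlU, hT, hTbot, hTtop, hT1, hT2⟩ := hT
    refine hinner (.hex1 (a + (l - y)) x (b + (l + m - y)) l (y + t - l) m) ?_ ?_ ?_
    · refine ⟨hm, by omega, by omega, by omega, (onAsc_iff (by omega)).2 ⟨by omega, by omega,
        fun w h1 h2 => ?_⟩, by convert htop using 2 <;> ring, hT, hTbot, hTtop,
        (onAsc_iff (by omega)).2 ⟨by omega, by omega, fun w h1 h2 => ?_⟩⟩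
      · have := hl3 w (by omega) (by omega)
        omega
      · have := hr3 w (by omega) (by omega)
        omega
    · simp only [DGPoly.Unpierced, Hex1Unpierced, isDot_iff]
      refine ⟨fun w h1 h2 h3 => ?_, fun w h1 h2 h3 => ?_, fun w h1 h2 h3 => ?_⟩
      · rcases le_or_gt w (a + t) with hw | hw
        · have := hl3 w (by omega) hw
          omega
        · exact hT1 w hw h2 h3.2.2
      · rcases lt_or_ge w b with hw | hw
        · exact hT2 w h1 hw h3.2.2
        · have := hr3 w hw (by omega)
          omega
      · exact hu2 w (by omega) (by omega) ⟨by omega, by omega, by omega⟩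
    · refine strictlyInside_of_dot (fun p hp => ?_) hda ?_ ?_ <;>
        simp only [DGPoly.Region, Hex1Region, BoxRegion, Set.mem_ofPred_eq] at * <;> omega
  · have hdiag := hQ.diagonal_bounds hσ (by omega) (by omega) hU hV
    obtain ⟨hQ, hQu, h1, h2, h3, h4⟩ := hQ
    refine hinner (.box a' b' y' t') hQ hQu (strictlyInside_of_dot (fun p hp => ?_) hda ?_ ?_) <;>
      simp only [DGPoly.Region, BoxRegion, Set.mem_ofPred_eq] at * <;> omega

theorem hex1Empty_of_innermost {σ : List ℕ} (hσ : Sawtooth σ) {a b c y L M : ℤ}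
    (hv : IsHex1 σ a b c y L M) (hu : Hex1Unpierced σ a b c y L M)
    (hinner : ∀ Q : DGPoly, Q.Valid σ → Q.Unpierced σ →
      ¬ StrictlyInside σ Q.Region (Hex1Region a b c y L M)) : Hex1Empty σ a b c y L M := by
  rintro ⟨i, h⟩ ⟨hyh, hhL, hai, hib, hic⟩ hd
  obtain ⟨hM, hML, hab, hbc, hl, htop, hr, hbot, hrtop, hc⟩ := hv
  have hda : IsDot σ a y := by simpa using hl 0 le_rfl (by omega)
  have hda' : IsDot σ (a + L) (y + L) := hl L (by omega) le_rfl
  obtain ⟨hl1, hl2, hl3⟩ := (onAsc_iff (by omega)).1 hl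
  obtain ⟨hr1, hr2, hr3⟩ := (onAsc_iff hM).1 hr
  obtain ⟨hc1, hc2, hc3⟩ := (onAsc_iff (by omega)).1 hc
  simp only [Hex1Unpierced, isDot_iff] at hu
  obtain ⟨hu1, hu2, hu3⟩ := hu
  obtain ⟨hi1, hi2, hih⟩ := isDot_iff.1 hd
  simp only at hyh hhL hai hib hic hi1 hi2 hih
  have hrU : dotHeight σ (b + M) = y + M := by rw [hr3 _ (by omega) le_rfl]; ring
  have hgap : ∀ w, b + M < w → w < c → dotHeight σ w < y + M := fun w h1 h2 =>
    hσ.dotHeight_lt_of_top (by omega) hrU hrtop h1 (by omega) fun v h3 h4 h5 =>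
      hu2 v h3 (by omega) ⟨by omega, by omega, h5⟩
  have hAi : a + L < i := by
    by_contra hlt
    have := hl3 i (by omega) (by omega)
    omega
  have hiB : i < b := by
    by_contra hlt
    rcases le_or_gt i (b + M) with hi | hi
    · have := hr3 i (by omega) hi
      omega
    · rcases lt_or_ge i c with hi' | hi'
      · have := hgap i hi hi'
        omega
      · have := hc3 i hi' (by omega)
        omega
  have hU : dotHeight σ (a + L) = y + L := by rw [hl3 _ (by omega) le_rfl]; ring
  have hV : dotHeight σ b = y := by rw [hr3 _ le_rfl (by omega)]; ring
  have hz := hσ.dotHeight_mem_Ioo (by omega) (by omega) hU htop hV hbot fun w h1 h2 =>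
    ⟨fun h3 => hu3 w h1 (by omega) ⟨by omega, by omega, h3⟩,
      fun h3 => hu1 w (by omega) h2 ⟨by omega, by omega, h3⟩⟩
  rcases exists_isolatedSeg_or_box hσ (by omega) (by omega) hAi hiB hU hV hz with
    ⟨x, l, m, hT⟩ | ⟨a', b', y', t', hQ⟩
  · have hdiag := hT.diagonal_bounds hσ (by omega) (by omega) hU hV
    obtain ⟨hm, hAx, hxB, hVl, hlU, hT, hTbot, hTtop, hT1, hT2⟩ := hT
    have hleft : ∀ w, a + (l - y) < w → w < x → dotHeight σ w ≠ l := fun w h1 h2 => by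
      rcases le_or_gt w (a + L) with hw | hw
      · have := hl3 w (by omega) hw
        omega
      · exact hT1 w hw h2
    rcases le_or_gt (l + m) (y + M) with hlm | hlm
    · refine hinner (.hex2 a b x y (l + m - y) m) ?_ ?_ ?_
      · have e : y + (l + m - y) - m = l := by ring
        have e' : y + (l + m - y) = l + m := by ring
        refine ⟨hm, by omega, hab, by omega, by omega, (onAsc_iff (by omega)).2 ⟨by omega,
          by omega, fun w h1 h2 => ?_⟩, by rwa [e], by rwa [e], by rwa [e'],
          (onAsc_iff (by omega)).2 ⟨by omega, by omega, fun w h1 h2 => ?_⟩, hbot⟩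
        · have := hl3 w (by omega) (by omega)
          omega
        · have := hr3 w (by omega) (by omega)
          omega
      · simp only [DGPoly.Unpierced, Hex2Unpierced, isDot_iff]
        refine ⟨fun w h1 h2 h3 => hu1 w h1 h2 h3, fun w h1 h2 h3 => ?_, fun w h1 h2 h3 => ?_⟩
        · exact hleft w (by omega) h2 (by omega)
        · rcases lt_or_ge w b with hw | hw
          · exact hT2 w h1 hw (by omega)
          · have := hr3 w hw (by omega)
            omega
      · refine strictlyInside_of_dot (fun p hp => ?_) hda' ?_ ?_ <;>
          simp only [DGPoly.Region, Hex1Region, Hex2Region, Set.mem_ofPred_eq] at * <;> omega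
    · refine hinner (.hex1 (a + (l - y)) x (c + (l + m - y - M)) l (y + L - l) m) ?_ ?_ ?_
      · refine ⟨hm, by omega, by omega, by omega, (onAsc_iff (by omega)).2 ⟨by omega, by omega,
          fun w h1 h2 => ?_⟩, by convert htop using 2 <;> ring, hT, hTbot, hTtop,
          (onAsc_iff (by omega)).2 ⟨by omega, by omega, fun w h1 h2 => ?_⟩⟩
        · have := hl3 w (by omega) (by omega)
          omega
        · have := hc3 w (by omega) (by omega)
          omega
      · simp only [DGPoly.Unpierced, Hex1Unpierced, isDot_iff]
        refine ⟨fun w h1 h2 h3 => hleft w h1 h2 h3.2.2, fun w h1 h2 h3 => ?_,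
          fun w h1 h2 h3 => ?_⟩
        · rcases lt_or_ge w b with hw | hw
          · exact hT2 w h1 hw h3.2.2
          · rcases le_or_gt w (b + M) with hw' | hw'
            · have := hr3 w hw hw'
              omega
            · rcases lt_or_ge w c with hw'' | hw''
              · have := hgap w hw' hw''
                omega
              · have := hc3 w hw'' (by omega)
                omega
        · exact hu3 w (by omega) (by omega) ⟨by omega, by omega, by omega⟩
      · refine strictlyInside_of_dot (fun p hp => ?_) hda ?_ ?_ <;>
          simp only [DGPoly.Region, Hex1Region, Set.mem_ofPred_eq] at * <;> omega
  · have hdiag := hQ.diagonal_bounds hσ (by omega) (by omega) hU hV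
    obtain ⟨hQ, hQu, h1, h2, h3, h4⟩ := hQ
    refine hinner (.box a' b' y' t') hQ hQu (strictlyInside_of_dot (fun p hp => ?_) hda ?_ ?_) <;>
      simp only [DGPoly.Region, BoxRegion, Hex1Region, Set.mem_ofPred_eq] at * <;> omega

theorem hex2Empty_of_innermost {σ : List ℕ} (hσ : Sawtooth σ) {p q r y L M : ℤ}
    (hv : IsHex2 σ p q r y L M) (hu : Hex2Unpierced σ p q r y L M)
    (hinner : ∀ Q : DGPoly, Q.Valid σ → Q.Unpierced σ →
      ¬ StrictlyInside σ Q.Region (Hex2Region p q r y L M)) : Hex2Empty σ p q r y L M := by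
  rintro ⟨i, h⟩ ⟨hyh, hhL, hiq, hip, hir⟩ hd
  obtain ⟨hM, hML, hpq, hpr, hrq, hp, hl, hlbot, htop, hr, hbot⟩ := hv
  have hdq : IsDot σ q y := by simpa using hr 0 le_rfl (by omega)
  have hdq' : IsDot σ (q + L) (y + L) := hr L (by omega) le_rfl
  obtain ⟨hp1, hp2, hp3⟩ := (onAsc_iff (by omega)).1 hp
  obtain ⟨hl1, hl2, hl3⟩ := (onAsc_iff hM).1 hl
  obtain ⟨hr1, hr2, hr3⟩ := (onAsc_iff (by omega)).1 hr
  simp only [Hex2Unpierced, isDot_iff] at hu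
  obtain ⟨hu1, hu2, hu3⟩ := hu
  obtain ⟨hi1, hi2, hih⟩ := isDot_iff.1 hd
  simp only at hyh hhL hiq hip hir hi1 hi2 hih
  have hlV : dotHeight σ r = y + L - M := by rw [hl3 _ le_rfl (by omega)]; ring
  have hgap : ∀ w, p + (L - M) < w → w < r → y + L - M < dotHeight σ w := fun w h1 h2 =>
    hσ.lt_dotHeight_of_bot (by omega) hlV hlbot (by omega) h2 fun v h3 h4 h5 =>
      hu2 v (by omega) h4 ⟨by omega, by omega, h5⟩
  have hiB : i < q := by
    by_contra hlt
    have := hr3 i (by omega) (by omega)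
    omega
  have hAi : r + M < i := by
    by_contra hlt
    rcases le_or_gt r i with hi | hi
    · have := hl3 i hi (by omega)
      omega
    · rcases lt_or_ge (p + (L - M)) i with hi' | hi'
      · have := hgap i hi' hi
        omega
      · have := hp3 i (by omega) hi'
        omega
  have hU : dotHeight σ (r + M) = y + L := by rw [hl3 _ (by omega) le_rfl]; ring
  have hV : dotHeight σ q = y := by rw [hr3 _ le_rfl (by omega)]; ring
  have hz := hσ.dotHeight_mem_Ioo (by omega) (by omega) hU htop hV hbot fun w h1 h2 =>
    ⟨fun h3 => hu3 w h1 (by omega) ⟨by omega, by omega, h3⟩,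
      fun h3 => hu1 w (by omega) h2 ⟨by omega, by omega, h3⟩⟩
  rcases exists_isolatedSeg_or_box hσ (by omega) (by omega) hAi hiB hU hV hz with
    ⟨x, l, m, hT⟩ | ⟨a', b', y', t', hQ⟩
  · have hdiag := hT.diagonal_bounds hσ (by omega) (by omega) hU hV
    obtain ⟨hm, hAx, hxB, hVl, hlU, hT, hTbot, hTtop, hT1, hT2⟩ := hT
    have hright : ∀ w, x + m < w → w < q + (l + m - y) → dotHeight σ w ≠ l + m :=
      fun w h1 h2 => by
        rcases lt_or_ge w q with hw | hw
        · exact hT2 w h1 hw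
        · have := hr3 w hw (by omega)
          omega
    rcases le_or_gt (y + L - M) l with hlm | hlm
    · refine hinner (.hex1 (r + (l - (y + L - M))) x (q + (l + m - y)) l (y + L - l) m) ?_ ?_ ?_
      · refine ⟨hm, by omega, by omega, by omega, (onAsc_iff (by omega)).2 ⟨by omega, by omega,
          fun w h1 h2 => ?_⟩, by convert htop using 2 <;> ring, hT, hTbot, hTtop,
          (onAsc_iff (by omega)).2 ⟨by omega, by omega, fun w h1 h2 => ?_⟩⟩
        · have := hl3 w (by omega) (by omega)
          omega
        · have := hr3 w (by omega) (by omega)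
          omega
      · simp only [DGPoly.Unpierced, Hex1Unpierced, isDot_iff]
        refine ⟨fun w h1 h2 h3 => ?_, fun w h1 h2 h3 => hright w h1 h2 h3.2.2,
          fun w h1 h2 h3 => ?_⟩
        · rcases le_or_gt w (r + M) with hw | hw
          · have := hl3 w (by omega) hw
            omega
          · exact hT1 w hw h2 h3.2.2
        · exact hu3 w (by omega) (by omega) ⟨by omega, by omega, by omega⟩
      · refine strictlyInside_of_dot (fun p hp => ?_) hdq ?_ ?_ <;>
          simp only [DGPoly.Region, Hex1Region, Hex2Region, Set.mem_ofPred_eq] at * <;> omega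
    · refine hinner (.hex2 p q x y (l + m - y) m) ?_ ?_ ?_
      · have e : y + (l + m - y) - m = l := by ring
        have e' : y + (l + m - y) = l + m := by ring
        refine ⟨hm, by omega, hpq, by omega, by omega, (onAsc_iff (by omega)).2 ⟨by omega,
          by omega, fun w h1 h2 => ?_⟩, by rwa [e], by rwa [e], by rwa [e'],
          (onAsc_iff (by omega)).2 ⟨by omega, by omega, fun w h1 h2 => ?_⟩, hbot⟩
        · exact hp3 w h1 (by omega)
        · exact hr3 w h1 (by omega)
      · simp only [DGPoly.Unpierced, Hex2Unpierced, isDot_iff]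
        refine ⟨fun w h1 h2 h3 => hu1 w h1 h2 h3, fun w h1 h2 h3 => ?_,
          fun w h1 h2 h3 => hright w h1 (by omega) (by omega)⟩
        rcases lt_or_ge (r + M) w with hw | hw
        · exact hT1 w hw h2 (by omega)
        · rcases le_or_gt r w with hw' | hw'
          · have := hl3 w hw' hw
            omega
          · rcases lt_or_ge (p + (L - M)) w with hw'' | hw''
            · have := hgap w hw'' hw'
              omega
            · have := hp3 w (by omega) hw''
              omega
      · refine strictlyInside_of_dot (fun p hp => ?_) hdq' ?_ ?_ <;>
          simp only [DGPoly.Region, Hex2Region, Set.mem_ofPred_eq] at * <;> omega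
  · have hdiag := hQ.diagonal_bounds hσ (by omega) (by omega) hU hV
    obtain ⟨hQ, hQu, h1, h2, h3, h4⟩ := hQ
    refine hinner (.box a' b' y' t') hQ hQu (strictlyInside_of_dot (fun p hp => ?_) hdq ?_ ?_) <;>
      simp only [DGPoly.Region, BoxRegion, Hex2Region, Set.mem_ofPred_eq] at * <;> omega

/-- An innermost unpierced box or hexagon of type 1 or 2 of `G(σ)`
(i.e. one such that no unpierced box or hexagon of type 1 or 2 is strictly inside it)
is empty. -/
theorem innermost_unpierced_is_empty (σ : List ℕ) (hsaw : Sawtooth σ)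
    (P : DGPoly) (hv : P.Valid σ) (hu : P.Unpierced σ)
    (hinner : ∀ Q : DGPoly, Q.Valid σ → Q.Unpierced σ →
      ¬ StrictlyInside σ Q.Region P.Region) :
    P.IsEmpty σ := by
  cases P with
  | box a b y t => exact boxEmpty_of_innermost hsaw hv hu hinner
  | hex1 a b c y L M => exact hex1Empty_of_innermost hsaw hv hu hinner
  | hex2 p q r y L M => exact hex2Empty_of_innermost hsaw hv hu hinner
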